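/- Let Λ > 0 and n ≥ 1, and let ψ ∈ L²(ℝ³ × (ℝ³)ⁿ; ℂ) be symmetric under permutations of the photon variables k₁, …, kₙ and satisfy (ψ, H_f ψ) < ∞. Then n ∫ χ(|k₁|) χ(|k_{n+1}|) |k₁|^{−1/2} |k_{n+1}|^{−1/2} |ψ(l, k₁, …, kₙ)| |ψ(l, k₂, …, k_{n+1})| dl dk₁⋯dk_{n+1} ≤ 4πΛ (ψ, H_f ψ). -/

import Mathlib

open MeasureTheory Real

/-- Splitting off the `i`-th photon variable. -/
def splitPhoton {X E : Type*} [MeasurableSpace X] [MeasurableSpace E] {n : ℕ} (i : Fin (n + 1)) :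
    X × (Fin (n + 1) → E) ≃ᵐ E × (X × (Fin n → E)) :=
  (((MeasurableEquiv.refl X).prodCongr (MeasurableEquiv.piFinSuccAbove (fun _ => E) i)).trans
    MeasurableEquiv.prodAssoc.symm).trans
    ((MeasurableEquiv.prodComm.prodCongr (MeasurableEquiv.refl _)).trans
      MeasurableEquiv.prodAssoc)

theorem splitPhoton_apply {X E : Type*} [MeasurableSpace X] [MeasurableSpace E] {n : ℕ}
    (i : Fin (n + 1)) (p : X × (Fin (n + 1) → E)) :
    splitPhoton i p = (p.2 i, (p.1, fun j => p.2 (i.succAbove j))) := rfl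

theorem measurePreserving_splitPhoton {X E : Type*} [MeasureSpace X] [MeasureSpace E]
    [SigmaFinite (volume : Measure X)] [SigmaFinite (volume : Measure E)] {n : ℕ}
    (i : Fin (n + 1)) :
    MeasurePreserving (splitPhoton (X := X) (E := E) i) volume volume := by
  have h1 := (MeasurePreserving.id (volume : Measure X)).prod
    (volume_preserving_piFinSuccAbove (fun _ : Fin (n + 1) => E) i)
  have h2 := (measurePreserving_prodAssoc (volume : Measure X) (volume : Measure E)
    (volume : Measure (Fin n → E))).symm
  have h3 := (Measure.measurePreserving_swap (μ := (volume : Measure X))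
    (ν := (volume : Measure E))).prod (MeasurePreserving.id (volume : Measure (Fin n → E)))
  have h4 := measurePreserving_prodAssoc (volume : Measure E) (volume : Measure X)
    (volume : Measure (Fin n → E))
  exact h4.comp (h3.comp (h2.comp h1))

section SplitIntegral

variable {X E : Type*} [MeasureSpace X] [MeasureSpace E]
  [SigmaFinite (volume : Measure X)] [SigmaFinite (volume : Measure E)] {n : ℕ}

theorem integrable_mul_succAbove (i : Fin (n + 1)) {w : E → ℝ} {G : X × (Fin n → E) → ℝ}
    (hw : Integrable w volume) (hG : Integrable G volume) :
    Integrable (fun p : X × (Fin (n + 1) → E) =>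
      w (p.2 i) * G (p.1, fun j => p.2 (i.succAbove j))) volume :=
  ((measurePreserving_splitPhoton i).integrable_comp_emb
    (splitPhoton i).measurableEmbedding).2 (hw.mul_prod hG)

theorem integral_mul_succAbove (i : Fin (n + 1)) (w : E → ℝ) (G : X × (Fin n → E) → ℝ) :
    ∫ p : X × (Fin (n + 1) → E), w (p.2 i) * G (p.1, fun j => p.2 (i.succAbove j)) =
      (∫ k, w k) * ∫ q, G q :=
  ((measurePreserving_splitPhoton i).integral_comp' (f := splitPhoton i)
    (fun z : E × (X × (Fin n → E)) => w z.1 * G z.2)).trans (integral_prod_mul w G)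

/-- The one-photon moments of a symmetric density do not depend on the photon. -/
theorem integral_coord_mul_eq_of_symmetric (g : E → ℝ) (F : X → (Fin n → E) → ℝ)
    (hF : ∀ l k (σ : Equiv.Perm (Fin n)), F l (k ∘ σ) = F l k) (i j : Fin n) :
    ∫ p : X × (Fin n → E), g (p.2 i) * F p.1 p.2 =
      ∫ p : X × (Fin n → E), g (p.2 j) * F p.1 p.2 := by
  let σ : Equiv.Perm (Fin n) := Equiv.swap i j
  let e : X × (Fin n → E) ≃ᵐ X × (Fin n → E) :=
    (MeasurableEquiv.refl X).prodCongr (MeasurableEquiv.arrowCongr' σ (MeasurableEquiv.refl E))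
  have he : MeasurePreserving e volume volume :=
    (MeasurePreserving.id (volume : Measure X)).prod
      (volume_preserving_arrowCongr' σ (MeasurableEquiv.refl E) (MeasurePreserving.id _))
  have hcomp : ∀ p, e p = (p.1, p.2 ∘ σ) := fun p => rfl
  rw [← he.integral_comp' (f := e)]
  simp only [hcomp, hF, Function.comp_apply, σ, Equiv.swap_apply_left]

end SplitIntegral

theorem integrable_and_integral_cutoff_inv_sq (Λ : ℝ) (hΛ : 0 < Λ) :
    Integrable (fun k : EuclideanSpace ℝ (Fin 3) => if ‖k‖ ≤ Λ then (‖k‖ ^ 2)⁻¹ else 0) volume ∧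
      ∫ k : EuclideanSpace ℝ (Fin 3), (if ‖k‖ ≤ Λ then (‖k‖ ^ 2)⁻¹ else 0) = 4 * π * Λ := by
  let f : ℝ → ℝ := fun t => if t ≤ Λ then (t ^ 2)⁻¹ else 0
  have hf : Set.EqOn ((Set.Iic Λ).indicator (fun _ => (1 : ℝ)))
      (fun y : ℝ => y ^ (Module.finrank ℝ (EuclideanSpace ℝ (Fin 3)) - 1) • f y) (Set.Ioi 0) := by
    intro y hy
    have hy' : y ≠ 0 := ne_of_gt hy
    by_cases h : y ≤ Λ <;> simp [f, h, hy']
  constructor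
  · refine (integrable_fun_norm_addHaar volume (f := f)).2 ?_
    refine IntegrableOn.congr_fun ?_ hf measurableSet_Ioi
    rw [IntegrableOn, integrable_indicator_iff measurableSet_Iic, IntegrableOn,
      Measure.restrict_restrict measurableSet_Iic, Set.inter_comm, Set.Ioi_inter_Iic]
    exact integrableOn_const (by simp)
  · have h := integral_fun_norm_addHaar
      (volume : Measure (EuclideanSpace ℝ (Fin 3))) f
    rw [← setIntegral_congr_fun measurableSet_Ioi hf,
      setIntegral_indicator measurableSet_Iic, Set.Ioi_inter_Iic] at h
    refine h.trans ?_
    rw [measureReal_def, EuclideanSpace.volume_ball_fin_three]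
    have : (0 : ℝ) ≤ π * 4 / 3 := by positivity
    simp [ENNReal.toReal_ofReal this, hΛ.le]
    ring

theorem rpow_neg_half_mul_le (a b P Q : ℝ) (ha : 0 ≤ a) (hb : 0 ≤ b) :
    a ^ (-(1 / 2) : ℝ) * b ^ (-(1 / 2) : ℝ) * P * Q ≤
      1 / 2 * ((a ^ 2)⁻¹ * (b * Q ^ 2) + (b ^ 2)⁻¹ * (a * P ^ 2)) := by
  rcases ha.eq_or_lt with rfl | ha
  · simp
  rcases hb.eq_or_lt with rfl | hb
  · simp
  obtain ⟨x, hx, rfl⟩ : ∃ x : ℝ, 0 < x ∧ a = x ^ 2 :=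
    ⟨√a, Real.sqrt_pos.2 ha, (Real.sq_sqrt ha.le).symm⟩
  obtain ⟨y, hy, rfl⟩ : ∃ y : ℝ, 0 < y ∧ b = y ^ 2 :=
    ⟨√b, Real.sqrt_pos.2 hb, (Real.sq_sqrt hb.le).symm⟩
  rw [Real.rpow_neg ha.le, Real.rpow_neg hb.le, ← Real.sqrt_eq_rpow, ← Real.sqrt_eq_rpow,
    Real.sqrt_sq hx.le, Real.sqrt_sq hy.le]
  have h := two_mul_le_add_sq (y * Q / x ^ 2) (x * P / y ^ 2)
  have h1 : 2 * (y * Q / x ^ 2) * (x * P / y ^ 2) = 2 * (x⁻¹ * y⁻¹ * P * Q) := by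
    field_simp
  have h2 : (y * Q / x ^ 2) ^ 2 + (x * P / y ^ 2) ^ 2 =
      ((x ^ 2) ^ 2)⁻¹ * (y ^ 2 * Q ^ 2) + ((y ^ 2) ^ 2)⁻¹ * (x ^ 2 * P ^ 2) := by
    field_simp
  linarith

theorem cutoff_mul_le (Λ a b P Q : ℝ) (ha : 0 ≤ a) (hb : 0 ≤ b) :
    (if a ≤ Λ then (1 : ℝ) else 0) * (if b ≤ Λ then (1 : ℝ) else 0) *
        a ^ (-(1 / 2) : ℝ) * b ^ (-(1 / 2) : ℝ) * P * Q ≤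
      1 / 2 * ((if a ≤ Λ then (a ^ 2)⁻¹ else 0) * (b * Q ^ 2) +
        (if b ≤ Λ then (b ^ 2)⁻¹ else 0) * (a * P ^ 2)) := by
  by_cases h1 : a ≤ Λ
  · by_cases h2 : b ≤ Λ
    · simpa only [h1, h2, if_true, one_mul] using rpow_neg_half_mul_le a b P Q ha hb
    · simp only [h1, h2, if_true, if_false, mul_zero, zero_mul, add_zero]
      positivity
  · by_cases h2 : b ≤ Λ
    · simp only [h1, h2, if_true, if_false, zero_mul, zero_add]
      positivity
    · simp [h1, h2]

/-- Off-diagonal (exchange) term `II_n` of Step 1 of Lemma B.1: for `ψ`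
symmetric in the photon variables with finite field energy,
`n ∫ χ(|k₁|)χ(|k_{n+1}|)|k₁|^{-1/2}|k_{n+1}|^{-1/2} |ψ(l,k₁,…,kₙ)| |ψ(l,k₂,…,k_{n+1})|
  ≤ 4πΛ (ψ, H_f ψ)`. -/
theorem exchange_term_bound (Λ : ℝ) (hΛ : 0 < Λ) (n : ℕ) (hn : 1 ≤ n)
    (ψ : EuclideanSpace ℝ (Fin 3) → (Fin n → EuclideanSpace ℝ (Fin 3)) → ℂ)
    (hmeas : AEStronglyMeasurable
      (fun p : EuclideanSpace ℝ (Fin 3) × (Fin n → EuclideanSpace ℝ (Fin 3)) =>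
        ψ p.1 p.2) volume)
    (hsym : ∀ (l : EuclideanSpace ℝ (Fin 3))
      (k : Fin n → EuclideanSpace ℝ (Fin 3)) (σ : Equiv.Perm (Fin n)),
      ψ l (k ∘ σ) = ψ l k)
    (hL2 : Integrable
      (fun p : EuclideanSpace ℝ (Fin 3) × (Fin n → EuclideanSpace ℝ (Fin 3)) =>
        ‖ψ p.1 p.2‖ ^ 2) volume)
    (hHf : Integrable
      (fun p : EuclideanSpace ℝ (Fin 3) × (Fin n → EuclideanSpace ℝ (Fin 3)) =>
        (∑ i, ‖p.2 i‖) * ‖ψ p.1 p.2‖ ^ 2) volume) :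
    (n : ℝ) *
        ∫ p : EuclideanSpace ℝ (Fin 3) × (Fin (n + 1) → EuclideanSpace ℝ (Fin 3)),
          (if ‖p.2 0‖ ≤ Λ then (1 : ℝ) else 0) *
            (if ‖p.2 (Fin.last n)‖ ≤ Λ then (1 : ℝ) else 0) *
            ‖p.2 0‖ ^ (-(1 / 2) : ℝ) * ‖p.2 (Fin.last n)‖ ^ (-(1 / 2) : ℝ) *
            ‖ψ p.1 (fun i => p.2 i.castSucc)‖ * ‖ψ p.1 (fun i => p.2 i.succ)‖ ≤
      4 * π * Λ *
        ∫ p : EuclideanSpace ℝ (Fin 3) × (Fin n → EuclideanSpace ℝ (Fin 3)),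
          (∑ i, ‖p.2 i‖) * ‖ψ p.1 p.2‖ ^ 2 := by
  obtain ⟨m, rfl⟩ : ∃ m, n = m + 1 := ⟨n - 1, by omega⟩
  obtain ⟨hw, hw_eq⟩ := integrable_and_integral_cutoff_inv_sq Λ hΛ
  set w : EuclideanSpace ℝ (Fin 3) → ℝ := fun k => if ‖k‖ ≤ Λ then (‖k‖ ^ 2)⁻¹ else 0
  let G : Fin (m + 1) → EuclideanSpace ℝ (Fin 3) × (Fin (m + 1) → EuclideanSpace ℝ (Fin 3)) → ℝ :=
    fun i p => ‖p.2 i‖ * ‖ψ p.1 p.2‖ ^ 2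
  have hG : ∀ i, Integrable (G i) volume := by
    intro i
    refine hHf.mono' ?_ (Filter.Eventually.of_forall fun p => ?_)
    · refine AEStronglyMeasurable.mul ?_ hL2.aestronglyMeasurable
      exact Continuous.aestronglyMeasurable (by fun_prop)
    · rw [Real.norm_of_nonneg (by positivity)]
      exact mul_le_mul_of_nonneg_right
        (Finset.single_le_sum (f := fun i => ‖p.2 i‖) (fun _ _ => norm_nonneg _)
          (Finset.mem_univ i)) (sq_nonneg _)
  have hG_eq : ∀ i j, ∫ p, G i p = ∫ p, G j p :=
    integral_coord_mul_eq_of_symmetric (fun k => ‖k‖) (fun l k => ‖ψ l k‖ ^ 2)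
      (fun l k σ => by rw [hsym])
  have hsum : ∫ p : EuclideanSpace ℝ (Fin 3) × (Fin (m + 1) → EuclideanSpace ℝ (Fin 3)),
      (∑ i, ‖p.2 i‖) * ‖ψ p.1 p.2‖ ^ 2 = ((m + 1 : ℕ) : ℝ) * ∫ p, G 0 p := by
    simp_rw [Finset.sum_mul]
    rw [integral_finsetSum _ fun i _ => hG i, Finset.sum_congr rfl fun i _ => hG_eq i 0]
    simp
  have hint0 := integrable_mul_succAbove 0 hw (hG (Fin.last m))
  have hintL := integrable_mul_succAbove (Fin.last (m + 1)) hw (hG 0)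
  have hle := integral_mono_of_nonneg
    (f := fun p : EuclideanSpace ℝ (Fin 3) × (Fin (m + 1 + 1) → EuclideanSpace ℝ (Fin 3)) =>
      (if ‖p.2 0‖ ≤ Λ then (1 : ℝ) else 0) *
        (if ‖p.2 (Fin.last (m + 1))‖ ≤ Λ then (1 : ℝ) else 0) *
        ‖p.2 0‖ ^ (-(1 / 2) : ℝ) * ‖p.2 (Fin.last (m + 1))‖ ^ (-(1 / 2) : ℝ) *
        ‖ψ p.1 (fun i => p.2 i.castSucc)‖ * ‖ψ p.1 (fun i => p.2 i.succ)‖)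
    (Filter.Eventually.of_forall fun p => by dsimp only [Pi.zero_apply]; positivity)
    ((hint0.add hintL).const_mul (1 / 2))
    (Filter.Eventually.of_forall fun p => by
      simpa [w, G] using cutoff_mul_le Λ ‖p.2 0‖ ‖p.2 (Fin.last (m + 1))‖
        ‖ψ p.1 (fun i => p.2 i.castSucc)‖ ‖ψ p.1 (fun i => p.2 i.succ)‖
        (norm_nonneg _) (norm_nonneg _))
  rw [integral_const_mul, integral_add' hint0 hintL, integral_mul_succAbove,
    integral_mul_succAbove, hw_eq, hG_eq (Fin.last m) 0] at hle
  rw [hsum]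
  calc _ ≤ ((m + 1 : ℕ) : ℝ) * (1 / 2 * (4 * π * Λ * (∫ p, G 0 p) + 4 * π * Λ * ∫ p, G 0 p)) :=
        mul_le_mul_of_nonneg_left hle (Nat.cast_nonneg _)
    _ = _ := by ring
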